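/- The volume of the tetrahedron A1P1Q1R1 equals x1³x2²x3 / ((1+x1)(1+x1+x1x2)(1+x1+x1x2+x1x2x3)) times the volume of the tetrahedron A1A2A3A4. -/

import Mathlib

open MeasureTheory

/-- A point of a segment is determined by the ratio of its distances to the endpoints. -/
theorem eq_lineMap_of_mem_segment_of_dist_eq {E : Type*} [NormedAddCommGroup E] [NormedSpace ℝ E]
    {A B P : E} {x : ℝ} (hx : 0 < x) (hAB : A ≠ B) (hP : P ∈ segment ℝ A B)
    (h : dist A P = x * dist P B) : P = AffineMap.lineMap A B (x / (1 + x)) := by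
  rw [segment_eq_image_lineMap] at hP
  obtain ⟨t, ⟨ht0, ht1⟩, rfl⟩ := hP
  rw [dist_left_lineMap, dist_lineMap_right, Real.norm_of_nonneg ht0,
    Real.norm_of_nonneg (sub_nonneg.2 ht1), ← mul_assoc] at h
  have h' := mul_right_cancel₀ (dist_ne_zero.2 hAB) h
  congr 1
  rw [eq_div_iff (by positivity)]
  linarith

open scoped Pointwise in
/-- A linear map scales the volume of a tetrahedron with a fixed vertex by its determinant. -/
theorem volume_convexHull_linearMap (f : EuclideanSpace ℝ (Fin 3) →ₗ[ℝ] EuclideanSpace ℝ (Fin 3))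
    (a u v w : EuclideanSpace ℝ (Fin 3)) :
    volume (convexHull ℝ ({a, a + f u, a + f v, a + f w} : Set (EuclideanSpace ℝ (Fin 3)))) =
      ENNReal.ofReal |LinearMap.det f| *
        volume (convexHull ℝ ({a, a + u, a + v, a + w} : Set (EuclideanSpace ℝ (Fin 3)))) := by
  have translate : ∀ u v w : EuclideanSpace ℝ (Fin 3),
      volume (convexHull ℝ ({a, a + u, a + v, a + w} : Set (EuclideanSpace ℝ (Fin 3)))) =
        volume (convexHull ℝ ({0, u, v, w} : Set (EuclideanSpace ℝ (Fin 3)))) := by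
    intro u v w
    have h : ({a, a + u, a + v, a + w} : Set (EuclideanSpace ℝ (Fin 3))) =
        a +ᵥ ({0, u, v, w} : Set (EuclideanSpace ℝ (Fin 3))) := by
      simp [← Set.image_vadd, Set.image_insert_eq]
    rw [h, convexHull_vadd, measure_vadd]
  rw [translate, translate, ← Measure.addHaar_image_linearMap, LinearMap.image_convexHull]
  simp [Set.image_insert_eq]

/-- Volume of a tetrahedron whose edge vectors from a vertex are triangular with respect to the
edge vectors of another tetrahedron with the same vertex. -/
theorem volume_convexHull_of_triangular {a u v w : EuclideanSpace ℝ (Fin 3)}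
    (h : LinearIndependent ℝ ![u, v, w]) (p q₁ q₂ r₁ r₂ r₃ : ℝ) :
    volume (convexHull ℝ ({a, a + p • u, a + (q₁ • u + q₂ • v),
        a + (r₁ • u + r₂ • v + r₃ • w)} : Set (EuclideanSpace ℝ (Fin 3)))) =
      ENNReal.ofReal |p * q₂ * r₃| *
        volume (convexHull ℝ ({a, a + u, a + v, a + w} : Set (EuclideanSpace ℝ (Fin 3)))) := by
  let b := basisOfLinearIndependentOfCardEqFinrank h (by simp)
  have hb : ⇑b = ![u, v, w] := coe_basisOfLinearIndependentOfCardEqFinrank h _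
  let f := Matrix.toLin b b !![p, q₁, r₁; 0, q₂, r₂; 0, 0, r₃]
  have hu : f u = p • u := by
    have := Matrix.toLin_self b b !![p, q₁, r₁; 0, q₂, r₂; 0, 0, r₃] 0
    simpa [hb, Fin.sum_univ_three] using this
  have hv : f v = q₁ • u + q₂ • v := by
    have := Matrix.toLin_self b b !![p, q₁, r₁; 0, q₂, r₂; 0, 0, r₃] 1
    simpa [hb, Fin.sum_univ_three] using this
  have hw : f w = r₁ • u + r₂ • v + r₃ • w := by
    have := Matrix.toLin_self b b !![p, q₁, r₁; 0, q₂, r₂; 0, 0, r₃] 2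
    simpa [hb, Fin.sum_univ_three] using this
  have hdet : LinearMap.det f = p * q₂ * r₃ := by
    simp [f, LinearMap.det_toLin, Matrix.det_fin_three]
  rw [← hdet, ← hu, ← hv, ← hw, volume_convexHull_linearMap]

theorem linearIndependent_sub_of_affineIndependent {E : Type*} [AddCommGroup E] [Module ℝ E]
    {A B C D : E} (h : AffineIndependent ℝ ![A, B, C, D]) :
    LinearIndependent ℝ ![B - A, C - A, D - A] := by
  rw [affineIndependent_iff_linearIndependent_vsub ℝ _ (0 : Fin 4)] at h
  have h' := h.comp (fun i : Fin 3 => (⟨i.succ, Fin.succ_ne_zero i⟩ : {x : Fin 4 // x ≠ 0}))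
    (fun i j hij => by simpa using hij)
  have hfun : ![B - A, C - A, D - A] = (fun i : {x : Fin 4 // x ≠ 0} =>
      (![A, B, C, D] i -ᵥ ![A, B, C, D] 0 : E)) ∘
        fun i : Fin 3 => ⟨i.succ, Fin.succ_ne_zero i⟩ := by
    funext i
    fin_cases i <;> simp
  rw [hfun]
  exact h'

theorem mem_affineSpan_triple_iff {E : Type*} [AddCommGroup E] [Module ℝ E] {A B C P : E} :
    P ∈ affineSpan ℝ ({A, B, C} : Set E) ↔ ∃ s t : ℝ, P = A + (s • (B - A) + t • (C - A)) := by
  have hA : A ∈ affineSpan ℝ ({A, B, C} : Set E) := mem_affineSpan ℝ (by simp)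
  rw [← AffineSubspace.vsub_right_mem_direction_iff_mem hA, direction_affineSpan,
    vectorSpan_eq_span_vsub_set_right ℝ (show A ∈ ({A, B, C} : Set E) by simp)]
  simp [Set.image_insert_eq, Submodule.mem_span_pair, eq_sub_iff_add_eq, eq_comm, add_comm]

/-- The volume of the tetrahedron `A₁P₁Q₁R₁` equals
`x₁³x₂²x₃ / ((1+x₁)(1+x₁+x₁x₂)(1+x₁+x₁x₂+x₁x₂x₃))` times the volume of the tetrahedron
`A₁A₂A₃A₄`, where `Q₁` is the intersection point of the lines `P₁A₃` and `A₁P₂` and `R₁`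
is the intersection point of the line `Q₁A₄` with the plane through `A₁`, `A₂`, `P₃`. -/
theorem routh_tetrahedron_triple_cut
    (A₁ A₂ A₃ A₄ P₁ P₂ P₃ Q₁ R₁ : EuclideanSpace ℝ (Fin 3))
    (x₁ x₂ x₃ : ℝ) (hx₁ : 0 < x₁) (hx₂ : 0 < x₂) (hx₃ : 0 < x₃)
    (hA : AffineIndependent ℝ ![A₁, A₂, A₃, A₄])
    (hP₁ : P₁ ∈ segment ℝ A₁ A₂) (hP₁r : dist A₁ P₁ = x₁ * dist P₁ A₂)
    (hP₂ : P₂ ∈ segment ℝ A₂ A₃) (hP₂r : dist A₂ P₂ = x₂ * dist P₂ A₃)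
    (hP₃ : P₃ ∈ segment ℝ A₃ A₄) (hP₃r : dist A₃ P₃ = x₃ * dist P₃ A₄)
    (hQ₁ : Q₁ ∈ affineSpan ℝ ({P₁, A₃} : Set (EuclideanSpace ℝ (Fin 3))))
    (hQ₁' : Q₁ ∈ affineSpan ℝ ({A₁, P₂} : Set (EuclideanSpace ℝ (Fin 3))))
    (hR₁ : R₁ ∈ affineSpan ℝ ({Q₁, A₄} : Set (EuclideanSpace ℝ (Fin 3))))
    (hR₁' : R₁ ∈ affineSpan ℝ ({A₁, A₂, P₃} : Set (EuclideanSpace ℝ (Fin 3)))) :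
    volume (convexHull ℝ ({A₁, P₁, Q₁, R₁} : Set (EuclideanSpace ℝ (Fin 3)))) =
      ENNReal.ofReal (x₁ ^ 3 * x₂ ^ 2 * x₃ /
          ((1 + x₁) * (1 + x₁ + x₁ * x₂) * (1 + x₁ + x₁ * x₂ + x₁ * x₂ * x₃))) *
        volume (convexHull ℝ ({A₁, A₂, A₃, A₄} : Set (EuclideanSpace ℝ (Fin 3)))) := by
  have hinj := hA.injective
  have h₁ := eq_lineMap_of_mem_segment_of_dist_eq hx₁
    (hinj.ne (show (0 : Fin 4) ≠ 1 by decide)) hP₁ hP₁r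
  have h₂ := eq_lineMap_of_mem_segment_of_dist_eq hx₂
    (hinj.ne (show (1 : Fin 4) ≠ 2 by decide)) hP₂ hP₂r
  have h₃ := eq_lineMap_of_mem_segment_of_dist_eq hx₃
    (hinj.ne (show (2 : Fin 4) ≠ 3 by decide)) hP₃ hP₃r
  have hli := linearIndependent_sub_of_affineIndependent hA
  obtain ⟨u, rfl⟩ : ∃ u, A₂ = A₁ + u := ⟨A₂ - A₁, by abel⟩
  obtain ⟨v, rfl⟩ : ∃ v, A₃ = A₁ + v := ⟨A₃ - A₁, by abel⟩
  obtain ⟨w, rfl⟩ : ∃ w, A₄ = A₁ + w := ⟨A₄ - A₁, by abel⟩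
  simp only [add_sub_cancel_left] at hli
  have coeff : ∀ a b c : ℝ, a • u + b • v + c • w = 0 → a = 0 ∧ b = 0 ∧ c = 0 := by
    intro a b c habc
    have := Fintype.linearIndependent_iff.1 hli ![a, b, c] (by
      simpa [Fin.sum_univ_three] using habc)
    exact ⟨this 0, this 1, this 2⟩
  obtain ⟨s, hs⟩ := mem_affineSpan_pair_iff_exists_lineMap_eq.1 hQ₁
  obtain ⟨t, ht⟩ := mem_affineSpan_pair_iff_exists_lineMap_eq.1 hQ₁'
  obtain ⟨r, hr⟩ := mem_affineSpan_pair_iff_exists_lineMap_eq.1 hR₁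
  obtain ⟨y, z, hyz⟩ := mem_affineSpan_triple_iff.1 hR₁'
  simp only [AffineMap.lineMap_apply_module] at h₁ h₂ h₃ hs ht hr
  obtain ⟨a₁, ha₁⟩ : ∃ a, a = x₁ / (1 + x₁) := ⟨_, rfl⟩
  obtain ⟨a₂, ha₂⟩ : ∃ a, a = x₂ / (1 + x₂) := ⟨_, rfl⟩
  obtain ⟨a₃, ha₃⟩ : ∃ a, a = x₃ / (1 + x₃) := ⟨_, rfl⟩
  simp only [Matrix.cons_val] at h₁ h₂ h₃
  rw [← ha₁] at h₁
  rw [← ha₂] at h₂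
  rw [← ha₃] at h₃
  have hP : P₁ = A₁ + a₁ • u := by rw [h₁]; module
  have hQ : Q₁ = A₁ + ((t * (1 - a₂)) • u + (t * a₂) • v) := by rw [← ht, h₂]; module
  have hR : R₁ = A₁ + (((1 - r) * (t * (1 - a₂))) • u + ((1 - r) * (t * a₂)) • v + r • w) := by
    rw [← hr, hQ]; module
  obtain ⟨e₁, e₂, -⟩ := coeff ((1 - s) * a₁ - t * (1 - a₂)) (s - t * a₂) 0 (by
    have : (1 - s) • P₁ + s • (A₁ + v) - Q₁ = 0 := by rw [hs, sub_self]
    rw [hP, hQ] at this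
    rw [← this]; module)
  obtain ⟨-, e₃, e₄⟩ := coeff ((1 - r) * (t * (1 - a₂)) - y)
    ((1 - r) * (t * a₂) - z * (1 - a₃)) (r - z * a₃) (by
    have := sub_eq_zero.2 hyz
    rw [hR, h₃] at this
    rw [← this]; module)
  have b₁ : 1 + x₁ ≠ 0 := by positivity
  have b₂ : 1 + x₂ ≠ 0 := by positivity
  have b₃ : 1 + x₃ ≠ 0 := by positivity
  have hta : t * a₂ = x₁ * x₂ / (1 + x₁ + x₁ * x₂) := by
    have d : 1 + x₁ + x₁ * x₂ ≠ 0 := by positivity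
    rw [eq_div_iff d]
    subst ha₁ ha₂
    field_simp at e₁ e₂ ⊢
    grind
  have hr' : r = x₁ * x₂ * x₃ / (1 + x₁ + x₁ * x₂ + x₁ * x₂ * x₃) := by
    have d : 1 + x₁ + x₁ * x₂ ≠ 0 := by positivity
    have d' : 1 + x₁ + x₁ * x₂ + x₁ * x₂ * x₃ ≠ 0 := by positivity
    rw [eq_div_iff d']
    rw [hta] at e₃
    subst ha₃
    field_simp at e₃ e₄ ⊢
    grind
  rw [hP, hQ, hR, volume_convexHull_of_triangular hli]
  congr 2
  rw [hta, hr', ha₁, abs_of_pos (by positivity)]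
  field_simp
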